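/- The only Fibonacci numbers that are concatenations of two Fibonacci numbers are 13, 21, and 55; equivalently, the solutions to F_n = F_m·10^d + F_l with m ≥ 1, where d is the number of digits of F_l ≥ 1, are exactly (F_n, F_m, F_l) ∈ {(13, 1, 3), (21, 2, 1), (55, 5, 5)}. -/

import Mathlib

/-! ### A congruence sieve for `fib n = fib m * 10 ^ D + fib l` -/

/-- `fibScan P k i a b` checks `P` at the `k` indices from `i` on, together with two consecutive
terms of the Fibonacci sequence modulo `1617322080` that starts with `a, b`. -/
def fibScan (P : ℕ → ℕ → ℕ → Bool) : ℕ → ℕ → ℕ → ℕ → Bool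
  | 0, _, _, _ => true
  | k + 1, i, a, b => P i a b && fibScan P k (i + 1) b ((a + b) % 1617322080)

/-- Residues for which `N = c * 10 ^ D + d` is impossible with `5 ≤ D`. -/
def excluded (N c d : ℕ) : Bool :=
  !Nat.beq (N % 160) (d % 160) || !Nat.beq (N % 3) ((c + d) % 3) ||
    (List.range 30).all fun e => !Nat.beq (N % 10108263) ((c * 10 ^ e + d) % 10108263)

/-- All pairs of residues modulo `240` that are not listed in `exc` are excluded. -/
def sieve (u x y : ℕ) (exc : ℕ → ℕ → Bool) : Bool :=
  fibScan (fun m a b => Nat.beq ((m + u) % 2) 0 ||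
    fibScan (fun l c d =>
      excluded ((a * x + b * y) * c + (a * y + b * (x + y)) * d) b d || exc m l) 240 0 0 1)
    240 0 0 1

lemma forall_of_fibScan {P : ℕ → ℕ → ℕ → Bool} {k i : ℕ}
    (h : fibScan P k i (Nat.fib i % 1617322080) (Nat.fib (i + 1) % 1617322080) = true) :
    ∀ j, i ≤ j → j < i + k →
      P j (Nat.fib j % 1617322080) (Nat.fib (j + 1) % 1617322080) = true := by
  induction k generalizing i with
  | zero => intro j h1 h2; omega
  | succ k ih =>
    rw [fibScan, Bool.and_eq_true, ← Nat.add_mod, ← Nat.fib_add_two] at h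
    intro j h1 h2
    rcases h1.eq_or_lt with rfl | h1
    · exact h.1
    · exact ih h.2 j h1 (by omega)

lemma fib_mod_two_forty (n : ℕ) :
    Nat.fib (n % 240) % 1617322080 = Nat.fib n % 1617322080 := by
  have key : ∀ k r : ℕ, Nat.fib (r + 240 * k) ≡ Nat.fib r [MOD 1617322080] := by
    intro k r
    induction k with
    | zero => exact Nat.ModEq.refl _
    | succ k ih =>
      refine Nat.ModEq.trans ?_ ih
      have h := Nat.fib_add (r + 240 * k) 239
      have h0 : Nat.fib 239 ≡ 1 [MOD 1617322080] := by norm_num [Nat.ModEq]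
      have h1 : Nat.fib (239 + 1) ≡ 0 [MOD 1617322080] := by norm_num [Nat.ModEq]
      rw [show r + 240 * (k + 1) = r + 240 * k + 239 + 1 by ring, h]
      simpa using (h0.mul_left _).add (h1.mul_left _)
  have := key (n / 240) (n % 240)
  rw [Nat.mod_add_div] at this
  exact this.symm

lemma ne_of_excluded {N c d n c' d' D : ℕ} (h : excluded N c d = true) (hD : 5 ≤ D)
    (hn : n ≡ N [MOD 1617322080]) (hc : c' ≡ c [MOD 1617322080])
    (hd : d' ≡ d [MOD 1617322080]) : n ≠ c' * 10 ^ D + d' := by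
  intro heq
  have hN : N ≡ c * 10 ^ D + d [MOD 1617322080] :=
    hn.symm.trans (heq ▸ (hc.mul_right _).add hd)
  have h1 : N ≡ d [MOD 160] := by
    refine (hN.of_dvd (by norm_num)).trans ?_
    have h5 : 10 ^ D ≡ 0 [MOD 160] :=
      (Nat.modEq_zero_iff_dvd).2 (dvd_trans (by norm_num) (pow_dvd_pow 10 hD))
    simpa using (h5.mul_left c).add_right d
  have h2 : N ≡ c + d [MOD 3] := by
    refine (hN.of_dvd (by norm_num)).trans ?_
    have h5 : 10 ^ D ≡ 1 ^ D [MOD 3] := Nat.ModEq.pow D (by decide)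
    rw [one_pow] at h5
    simpa using (h5.mul_left c).add_right d
  have h3 : N ≡ c * 10 ^ (D % 30) + d [MOD 10108263] := by
    refine (hN.of_dvd (by norm_num)).trans ?_
    have h30 : (10 ^ 30) ^ (D / 30) ≡ 1 ^ (D / 30) [MOD 10108263] :=
      Nat.ModEq.pow _ (by norm_num [Nat.ModEq])
    rw [one_pow, ← pow_mul] at h30
    have h5 := h30.mul_left (10 ^ (D % 30))
    rw [← pow_add, Nat.mod_add_div, mul_one] at h5
    exact (h5.mul_left c).add_right d
  have h4 : D % 30 < 30 := Nat.mod_lt _ (by norm_num)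
  simp only [excluded, Bool.or_eq_true, Bool.not_eq_true', List.all_eq_true, List.mem_range] at h
  rcases h with (h | h) | h
  · exact absurd h1 (Nat.ne_of_beq_eq_false h)
  · exact absurd h2 (Nat.ne_of_beq_eq_false h)
  · exact absurd h3 (Nat.ne_of_beq_eq_false (h _ h4))

lemma exc_of_sieve {u x y : ℕ} {exc : ℕ → ℕ → Bool} (h : sieve u x y exc = true)
    (hu : ∀ l, Nat.fib (l + u) = x * Nat.fib l + y * Nat.fib (l + 1)) {m l D : ℕ}
    (hmu : (m + u) % 2 = 1) (hD : 5 ≤ D)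
    (heq : Nat.fib (m + (l + u) + 1) = Nat.fib (m + 1) * 10 ^ D + Nat.fib (l + 1)) :
    exc (m % 240) (l % 240) = true := by
  have hm := forall_of_fibScan (i := 0) h (m % 240) (Nat.zero_le _)
    (by have := Nat.mod_lt m (show 240 > 0 by norm_num); omega)
  rw [Bool.or_eq_true] at hm
  rcases hm with hm | hm
  · have := Nat.eq_of_beq_eq_true hm
    omega
  have hl := forall_of_fibScan (i := 0) hm (l % 240) (Nat.zero_le _)
    (by have := Nat.mod_lt l (show 240 > 0 by norm_num); omega)
  rw [Bool.or_eq_true] at hl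
  refine hl.resolve_left fun hl => ?_
  have per : ∀ k, Nat.fib k ≡ Nat.fib (k % 240) % 1617322080 [MOD 1617322080] := fun k => by
    rw [Nat.ModEq, Nat.mod_mod, fib_mod_two_forty]
  have per1 : ∀ k,
      Nat.fib (k + 1) ≡ Nat.fib (k % 240 + 1) % 1617322080 [MOD 1617322080] := fun k => by
    rw [Nat.ModEq, Nat.mod_mod, ← fib_mod_two_forty (k + 1), ← fib_mod_two_forty (k % 240 + 1),
      Nat.mod_add_mod]
  refine ne_of_excluded hl hD ?_ (per1 m) (per1 l) heq
  have hu1 : Nat.fib (l + u + 1) = y * Nat.fib l + (x + y) * Nat.fib (l + 1) := by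
    rw [show l + u + 1 = l + 1 + u by ring, hu, Nat.fib_add_two]
    ring
  have e : Nat.fib (m + (l + u) + 1) = (Nat.fib m * x + Nat.fib (m + 1) * y) * Nat.fib l +
      (Nat.fib m * y + Nat.fib (m + 1) * (x + y)) * Nat.fib (l + 1) := by
    rw [Nat.fib_add, hu, hu1]
    ring
  rw [e]
  exact (((((per m).mul_right _).add ((per1 m).mul_right _)).mul (per l))).add
    ((((per m).mul_right _).add ((per1 m).mul_right _)).mul (per1 l))

set_option maxRecDepth 100000 in
lemma sieve_zero : sieve 0 1 0 (fun m l => m == 239 && l % 120 == 1) = true := by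
  decide +kernel

set_option maxRecDepth 100000 in
lemma sieve_one : sieve 1 0 1 (fun _ _ => false) = true := by
  decide +kernel

set_option maxRecDepth 100000 in
lemma sieve_two : sieve 2 1 1 (fun m l => m == 239 && l % 120 == 0) = true := by
  decide +kernel

set_option maxRecDepth 100000 in
lemma sieve_three : sieve 3 1 2 (fun _ _ => false) = true := by
  decide +kernel

set_option maxRecDepth 100000 in
lemma sieve_four : sieve 4 2 3 (fun m l => m == 239 && l % 120 == 118) = true := by
  decide +kernel

/-- If `m + u` is odd, a solution has `m + 1` divisible by `240` and `l` in a few residue classes. -/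
lemma sieve_conclusion {m l u D : ℕ} (hu : u ≤ 4) (hmu : (m + u) % 2 = 1) (hD : 5 ≤ D)
    (heq : Nat.fib (m + (l + u) + 1) = Nat.fib (m + 1) * 10 ^ D + Nat.fib (l + 1)) :
    m % 240 = 239 ∧ (u = 0 ∧ l % 120 = 1 ∨ u = 2 ∧ l % 120 = 0 ∨ u = 4 ∧ l % 120 = 118) := by
  interval_cases u
  · have h := exc_of_sieve sieve_zero (fun l => by simp) hmu hD heq
    simp only [Bool.and_eq_true, beq_iff_eq] at h
    omega
  · exact absurd (exc_of_sieve sieve_one (fun l => by simp) hmu hD heq) (by simp)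
  · have h := exc_of_sieve sieve_two (fun l => by rw [Nat.fib_add_two]; ring) hmu hD heq
    simp only [Bool.and_eq_true, beq_iff_eq] at h
    omega
  · exact absurd (exc_of_sieve sieve_three
      (fun l => by simp only [Nat.fib_add_two]; ring) hmu hD heq)
      (by simp)
  · have h := exc_of_sieve sieve_four (fun l => by
      simp only [Nat.fib_add_two]
      ring) hmu hD heq
    simp only [Bool.and_eq_true, beq_iff_eq] at h
    omega

/-! ### Identities and size estimates -/

lemma fib_add_fib_sub (m k : ℤ) : ∃ ε : ℤ, (ε = 1 ∧ Even k ∨ ε = -1 ∧ Odd k) ∧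
    Int.fib (m + k) + ε * Int.fib (m - k) = Int.fib m * (Int.fib (k + 1) + Int.fib (k - 1)) := by
  have h1 := Int.fib_add m k
  have h2 := Int.fib_add m (-k)
  have h3 := Int.fib_neg k
  have h4 := Int.fib_neg (k - 1)
  rw [← sub_eq_add_neg, show -k + 1 = -(k - 1) by ring] at h2
  rcases Int.even_or_odd k with hk | hk
  · have hk1 : ¬ Even (k - 1) := by grind
    rw [if_pos hk] at h3
    rw [if_neg hk1] at h4
    exact ⟨1, Or.inl ⟨rfl, hk⟩, by rw [h1, h2, h3, h4]; ring⟩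
  · have hk0 : ¬ Even k := by grind
    have hk1 : Even (k - 1) := by grind
    rw [if_neg hk0] at h3
    rw [if_pos hk1] at h4
    exact ⟨-1, Or.inr ⟨rfl, hk⟩, by rw [h1, h2, h3, h4]; ring⟩

lemma not_five_dvd_lucas (k : ℤ) : ¬ (5 : ℤ) ∣ Int.fib (k + 1) + Int.fib (k - 1) := by
  rintro ⟨c, hc⟩
  have h1 := Int.fib_succ_mul_fib_pred_sub_fib_sq k
  have h2 := Int.fib_add_two (k - 1)
  rw [show k - 1 + 2 = k + 1 by ring, sub_add_cancel] at h2
  rcases neg_one_pow_eq_or ℤ k.natAbs with h | h <;> rw [h] at h1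
  · have : 5 * (5 * c ^ 2 - Int.fib k ^ 2) = 4 := by
      linear_combination (-(5 * c) - (Int.fib (k + 1) + Int.fib (k - 1))) * hc + 4 * h1 +
        (Int.fib (k + 1) - Int.fib (k - 1) + Int.fib k) * h2
    omega
  · have : 5 * (5 * c ^ 2 - Int.fib k ^ 2) = -4 := by
      linear_combination (-(5 * c) - (Int.fib (k + 1) + Int.fib (k - 1))) * hc + 4 * h1 +
        (Int.fib (k + 1) - Int.fib (k - 1) + Int.fib k) * h2
    omega

lemma fib_five_mul (b : ℕ) : ∃ X : ℤ, (Nat.fib (5 * b) : ℤ) = 5 * (Nat.fib b * (1 + 5 * X)) := by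
  have h1 := Int.fib_succ_mul_fib_pred_sub_fib_sq b
  have h2 := Int.fib_add_two ((b : ℤ) - 1)
  have h3 := Int.fib_add b (2 * (2 * b))
  rw [show (b : ℤ) - 1 + 2 = b + 1 by ring, sub_add_cancel] at h2
  have h2' : Int.fib ((b : ℤ) - 1) = Int.fib (b + 1) - Int.fib b := by linarith
  rw [Int.fib_two_mul (2 * b), Int.fib_two_mul_add_one (2 * b), Int.fib_two_mul,
    Int.fib_two_mul_add_one, h2'] at h3
  rw [h2'] at h1
  rw [show (Nat.fib (5 * b) : ℤ) = Int.fib (b + 2 * (2 * b)) by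
    rw [← Int.fib_natCast]; push_cast; congr 1; ring, ← Int.fib_natCast b, h3]
  generalize Int.fib (b : ℤ) = F at *
  generalize Int.fib ((b : ℤ) + 1) = G at *
  have hN : (G * (G - F) - F ^ 2) ^ 2 = 1 := by
    rw [h1, ← pow_mul, mul_comm, pow_mul]; simp
  exact ⟨F ^ 4 + (G * (G - F) - F ^ 2) * F ^ 2, by linear_combination 5 * F * hN⟩

lemma five_pow_dvd_of_dvd_fib (D : ℕ) : ∀ a : ℕ, 5 ^ D ∣ Nat.fib a → 5 ^ D ∣ a := by
  induction D with
  | zero => simp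
  | succ D ih =>
    intro a h
    have h5 : 5 ∣ a := by
      have hg : Nat.fib (Nat.gcd 5 a) = 5 := by
        rw [Nat.fib_gcd]
        exact Nat.gcd_eq_left ((dvd_pow_self 5 (Nat.succ_ne_zero D)).trans h)
      rcases (Nat.dvd_prime Nat.prime_five).1 (Nat.gcd_dvd_left 5 a) with h1 | h1
      · rw [h1] at hg; simp at hg
      · exact Nat.gcd_eq_left_iff_dvd.1 h1
    obtain ⟨b, rfl⟩ := h5
    obtain ⟨X, hX⟩ := fib_five_mul b
    have h' : (5 : ℤ) ^ (D + 1) ∣ Nat.fib (5 * b) := by exact_mod_cast h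
    rw [hX, pow_succ', mul_dvd_mul_iff_left (by norm_num)] at h'
    have hcop : IsCoprime ((5 : ℤ) ^ D) (1 + 5 * X) :=
      IsCoprime.pow_left ⟨-X, 1, by ring⟩
    have := ih b (by exact_mod_cast hcop.dvd_of_dvd_mul_right h')
    rw [pow_succ']
    exact mul_dvd_mul_left 5 this

lemma fib_add_fib_lt {m r s : ℕ} (hm : 5 ≤ m) (hrs : r + s ≤ m + 1) (hr : r + 1 ≤ m)
    (hs : s + 1 ≤ m) : Nat.fib r + Nat.fib s < Nat.fib m := by
  wlog hle : r ≤ s generalizing r s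
  · rw [add_comm]
    exact this (by omega) hs hr (by omega)
  obtain ⟨k, rfl⟩ : ∃ k, m = k + 2 := ⟨m - 2, by omega⟩
  rw [Nat.fib_add_two]
  have hk : Nat.fib 3 ≤ Nat.fib k := Nat.fib_mono (by omega)
  have h3 : Nat.fib 3 = 2 := rfl
  have hlt : Nat.fib k < Nat.fib (k + 1) := Nat.fib_lt_fib_succ (by omega)
  rcases (show s ≤ k ∨ s = k + 1 by omega) with h | rfl
  · have h1 := Nat.fib_mono h
    have h2 := Nat.fib_mono (hle.trans h)
    omega
  · have h1 : Nat.fib r ≤ Nat.fib 2 := Nat.fib_mono (by omega)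
    rw [Nat.fib_two] at h1
    omega

lemma ten_pow_le_fib (D : ℕ) : 10 ^ D ≤ Nat.fib (5 * D + 2) := by
  induction D with
  | zero => simp
  | succ D ih =>
    have h1 : Nat.fib (5 * (D + 1) + 2) = 8 * Nat.fib (5 * D + 2) + 5 * Nat.fib (5 * D + 1) := by
      have := Nat.fib_add (5 * D + 1) 5
      rw [show 5 * (D + 1) + 2 = 5 * D + 1 + 5 + 1 by ring, this]
      norm_num
      ring
    have h2 : Nat.fib (5 * D + 2) = Nat.fib (5 * D) + Nat.fib (5 * D + 1) := Nat.fib_add_two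
    have h3 : Nat.fib (5 * D) ≤ Nat.fib (5 * D + 1) := Nat.fib_le_fib_succ
    rw [h1, pow_succ]
    omega

/-! ### The index of a concatenation -/

lemma index_bounds {n m l D : ℕ} (hm : 2 ≤ m) (hl : 2 ≤ l) (h1 : 10 ^ D ≤ 10 * Nat.fib l)
    (h2 : Nat.fib l < 10 ^ D) (heq : Nat.fib n = Nat.fib m * 10 ^ D + Nat.fib l) :
    ∃ u ≤ 4, n + 1 = m + l + u := by
  obtain ⟨m, rfl⟩ := Nat.exists_eq_add_of_le' hm
  obtain ⟨l, rfl⟩ := Nat.exists_eq_add_of_le' hl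
  have hb : 0 < Nat.fib (m + 1) := Nat.fib_pos.2 (by omega)
  have hd : 0 < Nat.fib (l + 1) := Nat.fib_pos.2 (by omega)
  have hab : Nat.fib m ≤ Nat.fib (m + 1) := Nat.fib_le_fib_succ
  have hcd : Nat.fib l ≤ Nat.fib (l + 1) := Nat.fib_le_fib_succ
  have lower : Nat.fib (m + l + 2) < Nat.fib n := by
    have h := Nat.fib_add m (l + 1)
    rw [show m + (l + 1) + 1 = m + l + 2 by ring] at h
    simp only [Nat.fib_add_two] at *
    nlinarith
  have upper : Nat.fib n < Nat.fib (m + l + 8) := by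
    have h := Nat.fib_add (m + 4) (l + 3)
    rw [show m + 4 + (l + 3) + 1 = m + l + 8 by ring] at h
    have e1 : Nat.fib (m + 4) = 2 * Nat.fib m + 3 * Nat.fib (m + 1) := by
      simp only [Nat.fib_add_two]
      ring
    have e2 : Nat.fib (m + 4 + 1) = 3 * Nat.fib m + 5 * Nat.fib (m + 1) := by
      rw [Nat.fib_add_two (n := m + 3), e1, Nat.fib_add_two (n := m + 1), Nat.fib_add_two]
      ring
    have e3 : Nat.fib (l + 3) = Nat.fib l + 2 * Nat.fib (l + 1) := by
      rw [Nat.fib_add_two (n := l + 1), Nat.fib_add_two]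
      ring
    have e4 : Nat.fib (l + 3 + 1) = 2 * Nat.fib l + 3 * Nat.fib (l + 1) := by
      rw [Nat.fib_add_two (n := l + 2), e3, Nat.fib_add_two]
      ring
    rw [h, e1, e2, e3, e4, heq]
    simp only [Nat.fib_add_two] at *
    nlinarith [Nat.mul_le_mul hab hcd, Nat.mul_pos hb hd,
      Nat.mul_le_mul_left (Nat.fib m + Nat.fib (m + 1)) h1]
  have h3 : m + l + 2 < n := by
    by_contra! h
    exact absurd (Nat.fib_mono h) (not_le.2 lower)
  have h4 : n < m + l + 8 := by
    by_contra! h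
    exact absurd (Nat.fib_mono h) (not_le.2 upper)
  exact ⟨n + 1 - (m + 2 + (l + 2)), by omega, by omega⟩

lemma le_add_five {n m l u D : ℕ} (hl : 2 ≤ l) (hu : u ≤ 4) (hn : n + 1 = m + l + u)
    (hD : 1 ≤ D) (heq : Nat.fib n = Nat.fib m * 10 ^ D + Nat.fib l) : m ≤ l + 5 := by
  by_contra! hml
  obtain ⟨k, hk⟩ : ∃ k, k + 1 = l + u := ⟨l + u - 1, by omega⟩
  obtain ⟨s, hs⟩ : ∃ s, m = k + s := ⟨m - k, by omega⟩
  obtain ⟨ε, hε, h⟩ := fib_add_fib_sub m k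
  have hnk : (m : ℤ) + k = (n : ℕ) := by omega
  have hsk : (m : ℤ) - k = (s : ℕ) := by omega
  rw [hnk, hsk, Int.fib_natCast, Int.fib_natCast, Int.fib_natCast, heq] at h
  have hlt := fib_add_fib_lt (m := m) (r := l) (s := s) (by omega) (by omega) (by omega) (by omega)
  have h5 := not_five_dvd_lucas k
  generalize Int.fib ((k : ℤ) + 1) + Int.fib ((k : ℤ) - 1) = L at *
  push_cast at h
  have hmul : (Nat.fib m : ℤ) * (L - 10 ^ D) = Nat.fib l + ε * Nat.fib s := by
    linear_combination -h
  have habs : |(Nat.fib l : ℤ) + ε * Nat.fib s| < Nat.fib m := by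
    rw [abs_lt]
    rcases hε with ⟨rfl, -⟩ | ⟨rfl, -⟩ <;> constructor <;> omega
  have hzero := Int.eq_zero_of_abs_lt_dvd (Dvd.intro _ hmul) habs
  rw [hzero] at hmul
  have hpos : (Nat.fib m : ℤ) ≠ 0 := by
    have : 0 < Nat.fib m := Nat.fib_pos.2 (by omega)
    omega
  have hL : L = 10 ^ D := by
    have := (mul_eq_zero.1 hmul).resolve_left hpos
    linarith
  exact h5 (hL ▸ dvd_pow (by norm_num) (by omega))

lemma false_of_even {n m l u D : ℕ} (hm : 2 ≤ m) (hu : u ≤ 4) (hml : m ≤ l + 5)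
    (hn : n + 1 = m + l + u) (hmu : (m + u) % 2 = 1) (hD : 5 ≤ D) (h2 : Nat.fib l < 10 ^ D)
    (heq : Nat.fib n = Nat.fib m * 10 ^ D + Nat.fib l) : False := by
  obtain ⟨p, hp⟩ : ∃ p, n = l + 2 * p := ⟨(n - l) / 2, by omega⟩
  have hl5 : l < 5 * D + 2 := by
    by_contra! h
    exact absurd (Nat.fib_mono h) (not_le.2 (h2.trans_le (ten_pow_le_fib D)))
  have hbig : l + p < 5 ^ D := by
    have : ∀ e, 15 * (e + 5) + 11 < 2 * 5 ^ (e + 5) := by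
      intro e
      induction e with
      | zero => norm_num
      | succ e ih => rw [show e + 1 + 5 = e + 5 + 1 by ring, pow_succ]; omega
    have h := this (D - 5)
    rw [Nat.sub_add_cancel hD] at h
    omega
  have key : ∀ a : ℕ, 0 < a → a ≤ l + p → ∀ L : ℤ, ¬ (5 : ℤ) ∣ L →
      (Nat.fib n : ℤ) - Nat.fib l ≠ Nat.fib a * L := by
    intro a ha hal L hL he
    have hcop : IsCoprime ((5 : ℤ) ^ D) L := IsCoprime.pow_left
      ((Nat.prime_iff_prime_int.1 Nat.prime_five).coprime_iff_not_dvd.2 hL)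
    have hdvd : (5 : ℤ) ^ D ∣ Nat.fib a * L := by
      rw [← he, heq]
      push_cast
      rw [add_sub_cancel_right]
      exact Dvd.dvd.mul_left (pow_dvd_pow_of_dvd (by norm_num) D) _
    have hd := five_pow_dvd_of_dvd_fib D a (by exact_mod_cast hcop.dvd_of_dvd_mul_right hdvd)
    have := Nat.le_of_dvd ha hd
    omega
  have e1 : ((l + p : ℕ) : ℤ) + (p : ℕ) = (n : ℕ) := by omega
  have e2 : ((l + p : ℕ) : ℤ) - (p : ℕ) = (l : ℕ) := by omega
  rcases Nat.even_or_odd p with hev | hodd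
  · obtain ⟨ε, hε, h⟩ := fib_add_fib_sub (p : ℕ) (l + p : ℕ)
    have hneg : ((p : ℕ) : ℤ) - (l + p : ℕ) = -(l : ℕ) := by omega
    rw [add_comm ((p : ℕ) : ℤ), e1, hneg, Int.fib_neg, Int.fib_natCast, Int.fib_natCast, Int.fib_natCast] at h
    refine key p (by omega) (by omega) _ (not_five_dvd_lucas _) (Eq.trans ?_ h)
    have hiff : Even ((l + p : ℕ) : ℤ) ↔ Even ((l : ℕ) : ℤ) := by
      push_cast
      exact Int.even_add.trans (by simp [hev])
    rcases hε with ⟨rfl, h1⟩ | ⟨rfl, h1⟩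
    · rw [if_pos (hiff.1 h1)]; ring
    · rw [if_neg (fun h0 => (Int.not_even_iff_odd.2 h1) (hiff.2 h0))]; ring
  · obtain ⟨ε, hε, h⟩ := fib_add_fib_sub (l + p : ℕ) (p : ℕ)
    rw [e1, e2, Int.fib_natCast, Int.fib_natCast, Int.fib_natCast] at h
    refine key (l + p) (by omega) le_rfl _ (not_five_dvd_lucas _) (Eq.trans ?_ h)
    rcases hε with ⟨rfl, h1⟩ | ⟨rfl, -⟩
    · exact absurd (by exact_mod_cast h1) (Nat.not_even_iff_odd.2 hodd)
    · ring

/-- The Fibonacci sequence modulo `fib m` is multiplied by a unit when the index grows by `m`. -/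
lemma dvd_reduce {m : ℕ} (r t : ℤ) (j : ℕ)
    (h : (Nat.fib m : ℤ) ∣ Int.fib (r + j * m + t) - Int.fib (r + j * m)) :
    (Nat.fib m : ℤ) ∣ Int.fib (r + t) - Int.fib r := by
  induction j with
  | zero => simpa using h
  | succ j ih =>
    apply ih
    have e1 := Int.fib_add m (r + j * m + t)
    have e2 := Int.fib_add m (r + j * m)
    have hcop : IsCoprime (Int.fib m) (Int.fib (m - 1)) := by
      rw [Int.isCoprime_iff_gcd_eq_one, Int.gcd_fib]
      simp
    rw [show r + (j + 1 : ℕ) * (m : ℤ) + t = m + (r + j * m + t) by push_cast; ring,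
      show r + (j + 1 : ℕ) * (m : ℤ) = m + (r + j * m) by push_cast; ring, e1, e2] at h
    rw [← Int.fib_natCast] at h ⊢
    refine hcop.dvd_of_dvd_mul_left ?_
    convert dvd_sub h (dvd_mul_right (Int.fib m)
      (Int.fib (r + j * m + t + 1) - Int.fib (r + j * m + 1))) using 1
    ring

lemma false_of_odd {n m l u D : ℕ} (hm : 2 ≤ m) (hl : 2 ≤ l) (hu : u ≤ 4)
    (hn : n + 1 = m + l + u) (hmu : (m + u) % 2 = 0) (hD : 5 ≤ D)
    (heq : Nat.fib n = Nat.fib m * 10 ^ D + Nat.fib l) : False := by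
  have hcong : m % 240 = 0 ∧
      (u = 0 ∧ l % 120 = 2 ∨ u = 2 ∧ l % 120 = 1 ∨ u = 4 ∧ l % 120 = 119) := by
    have h := sieve_conclusion (m := m - 1) (l := l - 1) (u := u) (D := D) hu (by omega) hD (by
      rw [show m - 1 + (l - 1 + u) + 1 = n by omega, Nat.sub_add_cancel (by omega),
        Nat.sub_add_cancel (by omega), heq])
    omega
  obtain ⟨hm240, hcong⟩ := hcong
  obtain ⟨q, rfl⟩ : 240 ∣ m := Nat.dvd_of_mod_eq_zero hm240
  have hlt : (l + 1) % (240 * q) < 240 * q := Nat.mod_lt _ (by omega)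
  have hmod : (l + 1) % (240 * q) % 120 = (l + 1) % 120 :=
    Nat.mod_mod_of_dvd _ (Dvd.intro _ (by ring : 120 * (2 * q) = 240 * q))
  have hdiv := Nat.mod_add_div (l + 1) (240 * q)
  generalize (l + 1) % (240 * q) = r' at *
  generalize (l + 1) / (240 * q) = j at *
  obtain ⟨r, s, hr, hrs, hr1, hrm, hs1, hsm, hsum⟩ : ∃ r s : ℕ,
      Int.fib ((r' : ℤ) - 1) = Nat.fib r ∧ (240 * q : ℕ) - ((r' : ℤ) - 1 + (u - 1)) = (s : ℕ) ∧
      1 ≤ r ∧ r + 1 ≤ 240 * q ∧ 1 ≤ s ∧ s + 1 ≤ 240 * q ∧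
      (r + s + u = 240 * q + 1 ∨ r = 1 ∧ s + 2 = 240 * q) := by
    rcases Nat.eq_zero_or_pos r' with rfl | hpos
    · exact ⟨1, 240 * q - 2, by simp, by omega, by omega, by omega, by omega, by omega, by omega⟩
    · refine ⟨r' - 1, 240 * q + 2 - r' - u, ?_, by omega, by omega, by omega, by omega, by omega,
        by omega⟩
      rw [← Int.fib_natCast]
      congr 1
      omega
  have hdvd := dvd_reduce (m := 240 * q) ((r' : ℤ) - 1) ((240 * q : ℕ) + ((u : ℤ) - 1)) j (by
    have el : (r' : ℤ) - 1 + j * (240 * q : ℕ) = (l : ℕ) := by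
      have : (r' : ℤ) + (240 * q : ℕ) * j = l + 1 := by exact_mod_cast hdiv
      linarith
    have en : (l : ℤ) + ((240 * q : ℕ) + ((u : ℤ) - 1)) = (n : ℕ) := by omega
    rw [el, en, Int.fib_natCast, Int.fib_natCast, heq]
    push_cast
    rw [add_sub_cancel_right]
    exact dvd_mul_right _ _)
  obtain ⟨ε, hε, h⟩ := fib_add_fib_sub (240 * q : ℕ) ((r' : ℤ) - 1 + (u - 1))
  rw [hrs, Int.fib_natCast, Int.fib_natCast] at h
  rw [hr, show (r' : ℤ) - 1 + ((240 * q : ℕ) + ((u : ℤ) - 1)) =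
    (240 * q : ℕ) + ((r' : ℤ) - 1 + (u - 1)) by ring] at hdvd
  have hsub := dvd_sub (Dvd.intro _ h.symm) hdvd
  rw [show ∀ a b c : ℤ, a + b - (a - c) = b + c by intros; ring] at hsub
  have hbound := fib_add_fib_lt (m := 240 * q) (r := r) (s := s) (by omega) (by omega) hrm hsm
  have hr0 : 0 < Nat.fib r := Nat.fib_pos.2 (by omega)
  have hs0 : 0 < Nat.fib s := Nat.fib_pos.2 (by omega)
  have hzero := Int.eq_zero_of_abs_lt_dvd hsub (by
    rw [abs_lt]
    rcases hε with ⟨rfl, -⟩ | ⟨rfl, -⟩ <;> constructor <;> omega)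
  have hfib : Nat.fib r = Nat.fib s := by
    rcases hε with ⟨rfl, -⟩ | ⟨rfl, -⟩ <;> omega
  have hlt_of : ∀ a b : ℕ, a < b → 100 ≤ b → Nat.fib a < Nat.fib b := by
    intro a b hab hb
    obtain ⟨b, rfl⟩ := Nat.exists_eq_add_of_le' (show 1 ≤ b by omega)
    exact (Nat.fib_mono (by omega : a ≤ b)).trans_lt (Nat.fib_lt_fib_succ (by omega))
  rcases lt_trichotomy r s with h' | h' | h'
  · exact (hlt_of r s h' (by omega)).ne hfib
  · omega
  · exact (hlt_of s r h' (by omega)).ne hfib.symm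

/-! ### Concatenations -/

/-- The claim for `n = m + l + u - 1` and a last part with `D` digits. -/
def ClaimAt (D l m u : ℕ) : Prop :=
  2 ≤ m → 2 ≤ l → Nat.fib l < 10 ^ D → 10 ^ D ≤ 10 * Nat.fib l →
    Nat.fib (m + l + u - 1) = Nat.fib m * 10 ^ D + Nat.fib l →
    (Nat.fib m = 1 ∧ Nat.fib l = 3 ∨ Nat.fib m = 2 ∧ Nat.fib l = 1 ∨
      Nat.fib m = 5 ∧ Nat.fib l = 5) ∧ D = 1

instance (D l m u : ℕ) : Decidable (ClaimAt D l m u) := by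
  unfold ClaimAt
  infer_instance

lemma claimAt_of_lt : ∀ D < 5, ∀ l < 22, ∀ m < 27, ∀ u < 5, ClaimAt D l m u := by
  decide +kernel

lemma concatenation_of_two_le {n m l D : ℕ} (hm : 2 ≤ m) (hl : 2 ≤ l)
    (h1 : 10 ^ D ≤ 10 * Nat.fib l) (h2 : Nat.fib l < 10 ^ D)
    (heq : Nat.fib n = Nat.fib m * 10 ^ D + Nat.fib l) :
    (Nat.fib m = 1 ∧ Nat.fib l = 3 ∨ Nat.fib m = 2 ∧ Nat.fib l = 1 ∨
      Nat.fib m = 5 ∧ Nat.fib l = 5) ∧ D = 1 := by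
  obtain ⟨u, hu, hn⟩ := index_bounds hm hl h1 h2 heq
  have hD : 1 ≤ D := by
    by_contra! h
    obtain rfl : D = 0 := by omega
    have := Nat.fib_pos.2 (show 0 < l by omega)
    omega
  have hml := le_add_five hl hu hn hD heq
  have hlD : l < 5 * D + 2 := by
    by_contra! h
    exact absurd (Nat.fib_mono h) (not_le.2 (h2.trans_le (ten_pow_le_fib D)))
  rcases Nat.lt_or_ge D 5 with h5 | h5
  · obtain rfl : n = m + l + u - 1 := by omega
    exact claimAt_of_lt D h5 l (by omega) m (by omega) u (by omega) hm hl h2 h1 heq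
  · rcases Nat.mod_two_eq_zero_or_one (m + u) with h | h
    · exact (false_of_odd hm hl hu hn h h5 heq).elim
    · exact (false_of_even hm hu hml hn h h5 h2 heq).elim

lemma exists_two_le_fib_eq {k : ℕ} (hk : 1 ≤ k) : ∃ k', 2 ≤ k' ∧ Nat.fib k' = Nat.fib k := by
  rcases hk.eq_or_lt with rfl | h
  · exact ⟨2, le_rfl, rfl⟩
  · exact ⟨k, h, rfl⟩

theorem stmt_18 (n m l : ℕ) (hm : 1 ≤ m) (hl : 1 ≤ Nat.fib l) :
    Nat.fib n = Nat.fib m * 10 ^ (Nat.digits 10 (Nat.fib l)).length + Nat.fib l ↔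
      (Nat.fib n, Nat.fib m, Nat.fib l) ∈
        ({(13, 1, 3), (21, 2, 1), (55, 5, 5)} : Set (ℕ × ℕ × ℕ)) := by
  simp only [Set.mem_insert_iff, Set.mem_singleton_iff, Prod.mk.injEq]
  constructor
  · intro heq
    have h2 : Nat.fib l < 10 ^ (Nat.digits 10 (Nat.fib l)).length :=
      Nat.lt_base_pow_length_digits (by norm_num)
    have h1 : 10 ^ (Nat.digits 10 (Nat.fib l)).length ≤ 10 * Nat.fib l :=
      Nat.base_pow_length_digits_le 10 _ (by norm_num) (by omega)
    obtain ⟨m', hm', em⟩ := exists_two_le_fib_eq hm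
    obtain ⟨l', hl', el⟩ := exists_two_le_fib_eq (Nat.fib_pos.1 hl)
    generalize (Nat.digits 10 (Nat.fib l)).length = D at *
    rw [← em, ← el] at *
    obtain ⟨h, rfl⟩ := concatenation_of_two_le hm' hl' h1 h2 heq
    omega
  · rintro (⟨h1, h2, h3⟩ | ⟨h1, h2, h3⟩ | ⟨h1, h2, h3⟩) <;> rw [h1, h2, h3] <;> norm_num
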